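/- arXiv:1805.08988 — 5 statements merged into one kernel-verified Lean document; each statement's English description precedes it below -/
import Mathlib

section
/- Let p be a positive integer and let θ, α ∈ ℝ. Let θ₀ ∈ Θ_α be a zero nearest to θ, i.e. |θ − θ₀| = inf{|θ − θ'| : θ' ∈ Θ_α}, and let θ* ∈ Θ* be a point nearest to θ₀, i.e. |θ₀ − θ*| = inf{|θ₀ − τ| : τ ∈ Θ*}. Then (p²/8)·|θ − θ₀|·|θ₀ − θ*| ≤ |Λ(θ,α)| ≤ p²·|θ − θ₀|·((1/2)|θ − θ₀| + |θ₀ − θ*|). -/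
/-- `Λ(θ,α) = cos(pθ) − (−1)^p cos(pα)`. -/
noncomputable def Lam (p : ℕ) (θ α : ℝ) : ℝ :=
  Real.cos (p * θ) - (-1 : ℝ) ^ p * Real.cos (p * α)

/-- `Θ_α = {θ ∈ ℝ : Λ(θ,α) = 0}`. -/
def ThetaAlpha (p : ℕ) (α : ℝ) : Set ℝ := {θ : ℝ | Lam p θ α = 0}

/-- `Θ* = {nπ/p : n ∈ ℤ}`. -/
def ThetaStar (p : ℕ) : Set ℝ := {τ : ℝ | ∃ n : ℤ, τ = n * Real.pi / p}

/-- A lower bound for `|sin u|` by the distance from `u` to a suitable multiple of `π`. -/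
theorem exists_int_mul_abs_sub_le_abs_sin (u : ℝ) :
    ∃ k : ℤ, 2 / Real.pi * |u - k * Real.pi| ≤ |Real.sin u| := by
  have hπ := Real.pi_pos
  have h : |u - round (u / Real.pi) * Real.pi| ≤ Real.pi / 2 := by
    have h1 := mul_le_mul_of_nonneg_right (abs_sub_round (u / Real.pi)) hπ.le
    rw [← abs_of_pos hπ, ← abs_mul, abs_of_pos hπ, sub_mul, div_mul_cancel₀ _ hπ.ne'] at h1
    linarith
  refine ⟨round (u / Real.pi), (Real.mul_abs_le_abs_sin h).trans_eq ?_⟩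
  rw [Real.sin_sub_int_mul_pi, abs_mul]
  simp

/-- Upper bound for `|cos x - cos a|` in terms of `|x - a|` and the distance from `a` to `nπ`. -/
theorem abs_cos_sub_cos_le (x a : ℝ) (n : ℤ) :
    |Real.cos x - Real.cos a| ≤ |x - a| * (|x - a| / 2 + |a - n * Real.pi|) := by
  have h1 : |Real.sin ((x - a) / 2)| ≤ |x - a| / 2 := by
    simpa [abs_div] using Real.abs_sin_le_abs (x := (x - a) / 2)
  have h2 : |Real.sin ((x + a) / 2)| ≤ |x - a| / 2 + |a - n * Real.pi| := by
    have h3 : |Real.sin ((x + a) / 2)| = |Real.sin ((x + a) / 2 - n * Real.pi)| := by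
      rw [Real.sin_sub_int_mul_pi, abs_mul]
      simp
    have h4 : (x + a) / 2 - n * Real.pi = (x - a) / 2 + (a - n * Real.pi) := by ring
    rw [h3]
    refine Real.abs_sin_le_abs.trans ?_
    rw [h4]
    refine (abs_add_le _ _).trans_eq ?_
    simp [abs_div]
  rw [Real.cos_sub_cos, abs_mul, abs_mul, abs_neg, abs_two]
  nlinarith [mul_le_mul h1 h2 (abs_nonneg _) (by positivity)]

/-- Lower bound for `|cos x - cos a|` when `a` is a nearest solution of `cos y = cos a` to `x`
and `d` is at most the distance from `a` to `πℤ`. -/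
theorem le_abs_cos_sub_cos (x a d : ℝ) (hd : 0 ≤ d)
    (hadd : ∀ k : ℤ, |x - a| ≤ |x - (a + 2 * k * Real.pi)|)
    (hneg : ∀ k : ℤ, |x - a| ≤ |x - (-a + 2 * k * Real.pi)|)
    (hda : ∀ k : ℤ, d ≤ |a - k * Real.pi|) :
    |x - a| * d / 8 ≤ |Real.cos x - Real.cos a| := by
  have hπ := Real.pi_pos
  have h1 : |x - a| / Real.pi ≤ |Real.sin ((x - a) / 2)| := by
    obtain ⟨k, h⟩ := exists_int_mul_abs_sub_le_abs_sin ((x - a) / 2)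
    have h3 : x - (a + 2 * k * Real.pi) = 2 * ((x - a) / 2 - k * Real.pi) := by ring
    have h4 := hadd k
    rw [h3, abs_mul, abs_two] at h4
    refine le_trans ?_ h
    rw [div_mul_eq_mul_div]
    gcongr
  have h2 : d / Real.pi ≤ |Real.sin ((x + a) / 2)| := by
    obtain ⟨k, h⟩ := exists_int_mul_abs_sub_le_abs_sin ((x + a) / 2)
    have h3 : x - (-a + 2 * k * Real.pi) = 2 * ((x + a) / 2 - k * Real.pi) := by ring
    have h4 := hneg k
    rw [h3, abs_mul, abs_two] at h4
    have h5 : a - k * Real.pi = ((x + a) / 2 - k * Real.pi) - (x - a) / 2 := by ring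
    have h6 := hda k
    rw [h5] at h6
    have h7 := abs_sub ((x + a) / 2 - k * Real.pi) ((x - a) / 2)
    rw [abs_div (x - a), abs_two] at h7
    refine le_trans ?_ h
    rw [div_mul_eq_mul_div]
    gcongr
    linarith
  rw [Real.cos_sub_cos, abs_mul, abs_mul, abs_neg, abs_two]
  have h8 : 2 * (|x - a| / Real.pi * (d / Real.pi)) ≤
      2 * (|Real.sin ((x - a) / 2)| * |Real.sin ((x + a) / 2)|) := by gcongr
  have h9 : |x - a| * d / 8 ≤ 2 * (|x - a| / Real.pi * (d / Real.pi)) := by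
    have h10 : 2 * (|x - a| / Real.pi * (d / Real.pi)) = |x - a| * d * (2 / Real.pi ^ 2) := by
      field_simp
    have h11 : (1 : ℝ) / 8 ≤ 2 / Real.pi ^ 2 := by
      rw [div_le_div_iff₀ (by norm_num) (by positivity)]
      nlinarith [Real.pi_le_four]
    rw [h10, div_eq_mul_one_div]
    gcongr
  linarith

/-- A point realising the infimum of distances to `S` is at least as near as any point of `S`. -/
theorem abs_sub_le_of_eq_sInf {S : Set ℝ} {x y z : ℝ}
    (h : |x - y| = sInf ((fun t => |x - t|) '' S)) (hz : z ∈ S) : |x - y| ≤ |x - z| := by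
  rw [h]
  exact csInf_le ⟨0, by rintro _ ⟨t, -, rfl⟩; exact abs_nonneg _⟩ ⟨z, hz, rfl⟩

/-- Lemma 1 (full two-sided bound): if `θ₀` is a point of `Θ_α` nearest to `θ`, and `θ*` a
point of `Θ*` nearest to `θ₀`, then
`(p²/8)·|θ−θ₀|·|θ₀−θ*| ≤ |Λ(θ,α)| ≤ p²·|θ−θ₀|·(|θ−θ₀|/2 + |θ₀−θ*|)`. -/
theorem lemma_HatBound (p : ℕ) (hp : 0 < p) (θ α θ₀ θstar : ℝ)
    (hθ₀ : θ₀ ∈ ThetaAlpha p α)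
    (hθ₀near : |θ - θ₀| = sInf ((fun θ' => |θ - θ'|) '' ThetaAlpha p α))
    (hθstar : θstar ∈ ThetaStar p)
    (hθstarnear : |θ₀ - θstar| = sInf ((fun τ => |θ₀ - τ|) '' ThetaStar p)) :
    (p : ℝ) ^ 2 / 8 * |θ - θ₀| * |θ₀ - θstar| ≤ |Lam p θ α| ∧
      |Lam p θ α| ≤ (p : ℝ) ^ 2 * |θ - θ₀| * (|θ - θ₀| / 2 + |θ₀ - θstar|) := by
  have hp' : (0 : ℝ) < p := by exact_mod_cast hp
  have hscale : ∀ s t : ℝ, |(p : ℝ) * s - p * t| = p * |s - t| := fun s t => by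
    rw [← mul_sub, abs_mul, abs_of_pos hp']
  have hcos : (-1 : ℝ) ^ p * Real.cos (p * α) = Real.cos (p * θ₀) := by
    have h : Real.cos (p * θ₀) - (-1 : ℝ) ^ p * Real.cos (p * α) = 0 := hθ₀
    linarith
  have hLam : Lam p θ α = Real.cos (p * θ) - Real.cos (p * θ₀) := by
    rw [Lam, hcos]
  have hzero : ∀ y : ℝ, Real.cos y = Real.cos (p * θ₀) →
      |(p : ℝ) * θ - p * θ₀| ≤ |p * θ - y| := fun y hy => by
    have hy' : (p : ℝ) * (y / p) = y := mul_div_cancel₀ _ hp'.ne'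
    have hmem : y / p ∈ ThetaAlpha p α := by
      change Real.cos (p * (y / p)) - (-1 : ℝ) ^ p * Real.cos (p * α) = 0
      rw [hy', hcos, hy, sub_self]
    rw [← hy', hscale, hscale]
    exact mul_le_mul_of_nonneg_left (abs_sub_le_of_eq_sInf hθ₀near hmem) hp'.le
  have hstar : ∀ k : ℤ, p * |θ₀ - θstar| ≤ |p * θ₀ - k * Real.pi| := fun k => by
    have hk : (p : ℝ) * (k * Real.pi / p) = k * Real.pi := mul_div_cancel₀ _ hp'.ne'
    rw [← hk, hscale]
    exact mul_le_mul_of_nonneg_left (abs_sub_le_of_eq_sInf hθstarnear ⟨k, rfl⟩) hp'.le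
  rw [hLam]
  constructor
  · have h := le_abs_cos_sub_cos (p * θ) (p * θ₀) (p * |θ₀ - θstar|) (by positivity)
      (fun k => hzero _ (by
        rw [show (p : ℝ) * θ₀ + 2 * k * Real.pi = p * θ₀ + k * (2 * Real.pi) by ring,
          Real.cos_add_int_mul_two_pi]))
      (fun k => hzero _ (by
        rw [show -((p : ℝ) * θ₀) + 2 * k * Real.pi = -(p * θ₀) + k * (2 * Real.pi) by ring,
          Real.cos_add_int_mul_two_pi, Real.cos_neg])) hstar
    rw [hscale] at h
    linarith
  · obtain ⟨n, hn⟩ := hθstar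
    have h := abs_cos_sub_cos_le (p * θ) (p * θ₀) n
    have hn' : (n : ℝ) * Real.pi = p * θstar := by
      rw [hn, mul_div_cancel₀ _ hp'.ne']
    rw [hn', hscale, hscale] at h
    linarith
end

section
/- Let p be a positive integer and let θ, α ∈ ℝ. Let θ₀ ∈ Θ_α be a zero nearest to θ, i.e. |θ − θ₀| = inf{|θ − θ'| : θ' ∈ Θ_α}, and let θ* ∈ Θ* be a point nearest to θ₀, i.e. |θ₀ − θ*| = inf{|θ₀ − τ| : τ ∈ Θ*}. Then |Λ(θ,α)| ≥ 2·|sin(p(θ − θ₀)/2)|·|sin(p(θ₀ − θ*)/2)|. -/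
/-- `|sin|` is `π`-periodic. -/
theorem abs_sin_sub_int_mul_pi (x : ℝ) (k : ℤ) :
    |Real.sin (x - k * Real.pi)| = |Real.sin x| := by
  rw [Real.sin_sub_int_mul_pi, abs_mul, abs_zpow, abs_neg, abs_one, one_zpow, one_mul]

/-- `|sin|` is monotone in the absolute value of its argument on `[-π/2, π/2]`. -/
theorem abs_sin_le_abs_sin {u v : ℝ} (huv : |u| ≤ |v|) (hv : |v| ≤ Real.pi / 2) :
    |Real.sin u| ≤ |Real.sin v| := by
  have hπ := Real.pi_pos
  rw [Real.abs_sin_eq_sin_abs_of_abs_le_pi (by linarith),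
    Real.abs_sin_eq_sin_abs_of_abs_le_pi (by linarith)]
  exact Real.sin_le_sin_of_le_of_le_pi_div_two (by linarith [abs_nonneg u]) hv huv

/-- `Θ_α` is invariant under reflection in a point `kπ/p`. -/
theorem reflect_mem_ThetaAlpha {p : ℕ} (hp : 0 < p) {α t : ℝ} (ht : t ∈ ThetaAlpha p α)
    (k : ℤ) : 2 * (k * Real.pi / p) - t ∈ ThetaAlpha p α := by
  have hp' : (p : ℝ) ≠ 0 := by positivity
  have h : (p : ℝ) * (2 * (k * Real.pi / p) - t) = k * (2 * Real.pi) - p * t := by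
    field_simp
  simpa only [ThetaAlpha, Lam, Set.mem_ofPred_eq, h, Real.cos_int_mul_two_pi_sub] using ht

/-- Lower bound in terms of sines: if `θ₀` is a point of `Θ_α` nearest to `θ` and `θ*` a point
of `Θ*` nearest to `θ₀`, then `|Λ(θ,α)| ≥ 2|sin(p(θ−θ₀)/2)|·|sin(p(θ₀−θ*)/2)|`. -/
theorem lower_bound_sines (p : ℕ) (hp : 0 < p) (θ α θ₀ θstar : ℝ)
    (hθ₀ : θ₀ ∈ ThetaAlpha p α)
    (hθ₀near : |θ - θ₀| = sInf ((fun θ' => |θ - θ'|) '' ThetaAlpha p α))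
    (hθstar : θstar ∈ ThetaStar p)
    (hθstarnear : |θ₀ - θstar| = sInf ((fun τ => |θ₀ - τ|) '' ThetaStar p)) :
    2 * |Real.sin (p * (θ - θ₀) / 2)| * |Real.sin (p * (θ₀ - θstar) / 2)| ≤ |Lam p θ α| := by
  have hp' : (0 : ℝ) < p := by exact_mod_cast hp
  have hπ := Real.pi_pos
  obtain ⟨n, rfl⟩ := hθstar
  set k : ℤ := round (p * (θ + θ₀) / 2 / Real.pi) with hk
  have hkle : |p * (θ + θ₀) / 2 - k * Real.pi| ≤ Real.pi / 2 := by
    have h := abs_sub_round (p * (θ + θ₀) / 2 / Real.pi)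
    rw [← hk] at h
    have e : p * (θ + θ₀) / 2 - k * Real.pi
        = (p * (θ + θ₀) / 2 / Real.pi - k) * Real.pi := by field_simp
    rw [e, abs_mul, abs_of_pos hπ]
    nlinarith
  have hrefl : |θ - θ₀| ≤ |θ - (2 * (k * Real.pi / p) - θ₀)| :=
    abs_sub_le_of_eq_sInf hθ₀near (reflect_mem_ThetaAlpha hp hθ₀ k)
  have hstar : |θ₀ - n * Real.pi / p| ≤ |θ₀ - k * Real.pi / p| :=
    abs_sub_le_of_eq_sInf hθstarnear ⟨k, rfl⟩
  have htri : 2 * |θ₀ - k * Real.pi / p|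
      ≤ |θ - (2 * (k * Real.pi / p) - θ₀)| + |θ - θ₀| := by
    have h := abs_sub (θ - (2 * (k * Real.pi / p) - θ₀)) (θ - θ₀)
    have e : θ - (2 * (k * Real.pi / p) - θ₀) - (θ - θ₀) = 2 * (θ₀ - k * Real.pi / p) := by
      ring
    rwa [e, abs_mul, abs_two] at h
  have hdist : |p * (θ₀ - n * Real.pi / p) / 2| ≤ |p * (θ + θ₀) / 2 - k * Real.pi| := by
    have e : p * (θ + θ₀) / 2 - k * Real.pi
        = p / 2 * (θ - (2 * (k * Real.pi / p) - θ₀)) := by field_simp; ring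
    rw [e, mul_div_right_comm, abs_mul, abs_mul]
    exact mul_le_mul_of_nonneg_left (by linarith) (abs_nonneg _)
  have hsin : |Real.sin (p * (θ₀ - n * Real.pi / p) / 2)| ≤ |Real.sin (p * (θ + θ₀) / 2)| :=
    (abs_sin_le_abs_sin hdist hkle).trans_eq (abs_sin_sub_int_mul_pi _ k)
  have hLam : |Lam p θ α|
      = 2 * |Real.sin (p * (θ - θ₀) / 2)| * |Real.sin (p * (θ + θ₀) / 2)| := by
    have h₀ : Real.cos (p * θ₀) - (-1 : ℝ) ^ p * Real.cos (p * α) = 0 := hθ₀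
    rw [Lam, ← sub_eq_zero.mp h₀, Real.cos_sub_cos, ← mul_add, ← mul_sub, abs_mul, abs_mul,
      abs_neg, abs_two]
    ring
  rw [hLam]
  gcongr
end

section
/- Let p be a positive integer and let θ, α ∈ ℝ. Let θ₀ ∈ Θ_α be a zero nearest to θ, i.e. |θ − θ₀| = inf{|θ − θ'| : θ' ∈ Θ_α}, and let θ* ∈ Θ* be a point nearest to θ₀, i.e. |θ₀ − θ*| = inf{|θ₀ − τ| : τ ∈ Θ*}. Then |sin(p(θ* + θ₀)/2)| ≤ |sin(p(θ + θ₀)/2)|. -/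
/-- A point of `s` realizing the infimum of the distances from `a` is at least as close to `a`
as every other point of `s`. -/
theorem abs_sub_le_of_eq_sInf_s3 {s : Set ℝ} {a b c : ℝ}
    (h : |a - b| = sInf ((fun t => |a - t|) '' s)) (hc : c ∈ s) : |a - b| ≤ |a - c| := by
  rw [h]
  refine csInf_le ⟨0, ?_⟩ ⟨c, hc, rfl⟩
  rintro _ ⟨t, -, rfl⟩
  exact abs_nonneg _

theorem abs_sin_le_abs_sin_of_cos_two_mul_le {u v : ℝ}
    (h : Real.cos (2 * v) ≤ Real.cos (2 * u)) : |Real.sin u| ≤ |Real.sin v| := by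
  rw [← sq_le_sq, Real.sin_sq_eq_half_sub, Real.sin_sq_eq_half_sub]
  linarith

theorem cos_add_le_cos {d e : ℝ} (hde : 0 ≤ e * d) (hd : |d| ≤ Real.pi / 2)
    (he : |e| ≤ Real.pi) : Real.cos (e + d) ≤ Real.cos d := by
  obtain ⟨hd₁, hd₂⟩ := abs_le.mp hd
  obtain ⟨he₁, he₂⟩ := abs_le.mp he
  rcases mul_nonneg_iff.mp hde with ⟨h₁, h₂⟩ | ⟨h₁, h₂⟩
  · have h := mul_nonneg
      (Real.sin_nonneg_of_nonneg_of_le_pi (x := (e + d + d) / 2) (by linarith) (by linarith))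
      (Real.sin_nonneg_of_nonneg_of_le_pi (x := (e + d - d) / 2) (by linarith) (by linarith))
    linarith [Real.cos_sub_cos (e + d) d]
  · have h := mul_nonneg_of_nonpos_of_nonpos
      (Real.sin_nonpos_of_nonpos_of_neg_pi_le (x := (e + d + d) / 2) (by linarith) (by linarith))
      (Real.sin_nonpos_of_nonpos_of_neg_pi_le (x := (e + d - d) / 2) (by linarith) (by linarith))
    linarith [Real.cos_sub_cos (e + d) d]

/-- If `θ₀` is a point of `Θ_α` nearest to `θ` and `θ*` a point of `Θ*` nearest to `θ₀`,
then `|sin(p(θ*+θ₀)/2)| ≤ |sin(p(θ+θ₀)/2)|`. -/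
theorem sin_nearest_ineq (p : ℕ) (hp : 0 < p) (θ α θ₀ θstar : ℝ)
    (hθ₀ : θ₀ ∈ ThetaAlpha p α)
    (hθ₀near : |θ - θ₀| = sInf ((fun θ' => |θ - θ'|) '' ThetaAlpha p α))
    (hθstar : θstar ∈ ThetaStar p)
    (hθstarnear : |θ₀ - θstar| = sInf ((fun τ => |θ₀ - τ|) '' ThetaStar p)) :
    |Real.sin (p * (θstar + θ₀) / 2)| ≤ |Real.sin (p * (θ + θ₀) / 2)| := by
  have hp' : (0 : ℝ) < p := Nat.cast_pos.mpr hp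
  have hpi := Real.pi_pos
  obtain ⟨n, rfl⟩ := hθstar
  obtain ⟨d, hd⟩ : ∃ d : ℝ, d = p * θ₀ - n * Real.pi := ⟨_, rfl⟩
  obtain ⟨e, he⟩ : ∃ e : ℝ, e = p * θ - n * Real.pi := ⟨_, rfl⟩
  have scale {a b c f : ℝ} (h : |a - b| ≤ |c - f|) : (p * a - p * b) ^ 2 ≤ (p * c - p * f) ^ 2 := by
    rw [← mul_sub, ← mul_sub, mul_pow, mul_pow]
    exact mul_le_mul_of_nonneg_left (sq_le_sq.mpr h) (sq_nonneg _)
  have star (m : ℤ) : d ^ 2 ≤ (d + n * Real.pi - m * Real.pi) ^ 2 := by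
    have h := scale (abs_sub_le_of_eq_sInf_s3 hθstarnear ⟨m, rfl⟩)
    rw [mul_div_cancel₀ _ hp'.ne', mul_div_cancel₀ _ hp'.ne'] at h
    rw [hd]
    convert h using 2
    ring
  have reflect (m : ℤ) : (e - d) ^ 2 ≤ (e + d + 2 * n * Real.pi - 2 * m * Real.pi) ^ 2 := by
    have hm : (m * (2 * Real.pi) - p * θ₀) / p ∈ ThetaAlpha p α := by
      change Real.cos _ - _ = 0
      rw [mul_div_cancel₀ _ hp'.ne', Real.cos_int_mul_two_pi_sub]
      exact hθ₀
    have h := scale (abs_sub_le_of_eq_sInf_s3 hθ₀near hm)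
    rw [mul_div_cancel₀ _ hp'.ne'] at h
    rw [hd, he]
    convert h using 2 <;> ring
  have hd₁ := star (n + 1)
  have hd₂ := star (n - 1)
  have he₀ := reflect n
  have he₁ := reflect (n + 1)
  have he₂ := reflect (n - 1)
  push_cast at hd₁ hd₂ he₁ he₂
  have hd_le : d ≤ Real.pi / 2 := by
    by_contra! h
    nlinarith
  have hd_ge : -(Real.pi / 2) ≤ d := by
    by_contra! h
    nlinarith
  have he_le : e ≤ Real.pi := by
    by_contra! h
    nlinarith [mul_pos (sub_pos.mpr h) (by linarith : 0 < Real.pi - d)]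
  have he_ge : -Real.pi ≤ e := by
    by_contra! h
    nlinarith [mul_pos (sub_pos.mpr h) (by linarith : 0 < Real.pi + d)]
  have hcos := cos_add_le_cos (by nlinarith) (abs_le.mpr ⟨hd_ge, hd_le⟩)
    (abs_le.mpr ⟨he_ge, he_le⟩)
  apply abs_sin_le_abs_sin_of_cos_two_mul_le
  have h₁ : 2 * (p * (θ + θ₀) / 2) = e + d + n * (2 * Real.pi) := by
    rw [hd, he]
    ring
  have h₂ : 2 * (p * (n * Real.pi / p + θ₀) / 2) = d + n * (2 * Real.pi) := by
    rw [hd]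
    field_simp
    ring
  rwa [h₁, h₂, Real.cos_add_int_mul_two_pi, Real.cos_add_int_mul_two_pi]
end

section
/- Let p be a positive integer and let α ∈ ℝ. Then Θ_α ⊆ Θ* if and only if α ∈ Θ*. -/
/-- Membership in `Θ*` is the vanishing of `sin (pτ)`. -/
theorem mem_ThetaStar_iff_sin_eq_zero {p : ℕ} (hp : 0 < p) (τ : ℝ) :
    τ ∈ ThetaStar p ↔ Real.sin (p * τ) = 0 := by
  have hp' : (p : ℝ) ≠ 0 := by positivity
  rw [Real.sin_eq_zero_iff]
  refine exists_congr fun n => ?_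
  rw [eq_div_iff hp', mul_comm τ, eq_comm]

/-- The angle `α + π` always lies in `Θ_α`. -/
theorem add_pi_mem_ThetaAlpha (p : ℕ) (α : ℝ) : α + Real.pi ∈ ThetaAlpha p α := by
  change Real.cos (p * (α + Real.pi)) - (-1 : ℝ) ^ p * Real.cos (p * α) = 0
  rw [mul_add, Real.cos_add_nat_mul_pi, sub_self]

/-- Every `θ ∈ Θ_α` satisfies `sin² (pθ) = sin² (pα)`. -/
theorem sin_sq_eq_of_mem_ThetaAlpha {p : ℕ} {θ α : ℝ} (h : θ ∈ ThetaAlpha p α) :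
    Real.sin (p * θ) ^ 2 = Real.sin (p * α) ^ 2 := by
  have hcos : Real.cos (p * θ) = (-1 : ℝ) ^ p * Real.cos (p * α) := sub_eq_zero.mp h
  rw [Real.sin_sq, Real.sin_sq, hcos, mul_pow, ← pow_mul, mul_comm p, pow_mul, neg_one_sq,
    one_pow, one_mul]

/-- `Θ_α ⊆ Θ*` if and only if `α ∈ Θ*`. -/
theorem ThetaAlpha_subset_iff (p : ℕ) (hp : 0 < p) (α : ℝ) :
    ThetaAlpha p α ⊆ ThetaStar p ↔ α ∈ ThetaStar p := by
  have key {θ : ℝ} (h : θ ∈ ThetaAlpha p α) : θ ∈ ThetaStar p ↔ α ∈ ThetaStar p := by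
    rw [mem_ThetaStar_iff_sin_eq_zero hp, mem_ThetaStar_iff_sin_eq_zero hp,
      ← sq_eq_zero_iff, sin_sq_eq_of_mem_ThetaAlpha h, sq_eq_zero_iff]
  have hπ := add_pi_mem_ThetaAlpha p α
  exact ⟨fun h => (key hπ).mp (h hπ), fun hα _ hθ => (key hθ).mpr hα⟩
end

section
/- Let p be a positive integer and let α ∈ ℝ with α ∈ Θ* (equivalently, pα is an integer multiple of π). Then the set Θ_α ∩ [0, 2π) = {θ ∈ [0,2π) : Λ(θ,α) = 0} contains exactly p elements, and each of these elements belongs to Θ*. -/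
/-- For an integer `m`, the solutions of `cos (pθ) = cos (mπ)` are the points `(2k + m)π/p`. -/
theorem cos_nat_mul_eq_cos_int_mul_pi_iff {p : ℕ} (hp : 0 < p) (m : ℤ) (θ : ℝ) :
    Real.cos (p * θ) = Real.cos (m * Real.pi) ↔
      ∃ k : ℤ, θ = ((2 * k + m : ℤ) : ℝ) * Real.pi / p := by
  have hp0 : (p : ℝ) ≠ 0 := by positivity
  rw [eq_comm, Real.cos_eq_cos_iff]
  constructor
  · rintro ⟨k, h | h⟩
    · refine ⟨k, ?_⟩
      rw [eq_div_iff hp0]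
      push_cast
      linarith
    · refine ⟨k - m, ?_⟩
      rw [eq_div_iff hp0]
      push_cast
      linarith
  · rintro ⟨k, h⟩
    rw [eq_div_iff hp0] at h
    push_cast at h
    exact ⟨k, Or.inl (by linarith)⟩

/-- If `α ∈ Θ*`, then `Θ_α` is the set of points `(2k + r)π/p` for some `r ∈ {0, 1}`. -/
theorem exists_mem_ThetaAlpha_iff {p : ℕ} (hp : 0 < p) {α : ℝ} (hα : α ∈ ThetaStar p) :
    ∃ r : ℤ, 0 ≤ r ∧ r < 2 ∧
      ∀ θ, θ ∈ ThetaAlpha p α ↔ ∃ k : ℤ, θ = ((2 * k + r : ℤ) : ℝ) * Real.pi / p := by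
  obtain ⟨n, rfl⟩ := hα
  have hp0 : (p : ℝ) ≠ 0 := by positivity
  refine ⟨(p + n) % 2, Int.emod_nonneg _ two_ne_zero, Int.emod_lt_of_pos _ two_pos, fun θ => ?_⟩
  have hcos : (-1 : ℝ) ^ p * Real.cos (p * (n * Real.pi / p)) =
      Real.cos (((p + n : ℤ) : ℝ) * Real.pi) := by
    rw [mul_div_cancel₀ _ hp0, Real.cos_int_mul_pi, Real.cos_int_mul_pi,
      zpow_add₀ (by norm_num), zpow_natCast]
  simp only [ThetaAlpha, Lam, Set.mem_ofPred_eq, sub_eq_zero, hcos,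
    cos_nat_mul_eq_cos_int_mul_pi_iff hp]
  have hdiv := Int.emod_add_mul_ediv ((p : ℤ) + n) 2
  constructor
  · rintro ⟨k, rfl⟩
    refine ⟨k + (p + n) / 2, ?_⟩
    congr 3
    linarith
  · rintro ⟨k, rfl⟩
    refine ⟨k - (p + n) / 2, ?_⟩
    congr 3
    linarith

/-- The point `mπ/p` lies in `[0, 2π)` exactly when `0 ≤ m < 2p`. -/
theorem int_mul_pi_div_mem_Ico_iff {p : ℕ} (hp : 0 < p) (m : ℤ) :
    (m : ℝ) * Real.pi / p ∈ Set.Ico (0 : ℝ) (2 * Real.pi) ↔ 0 ≤ m ∧ m < 2 * p := by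
  have hp0 : (0 : ℝ) < p := by exact_mod_cast hp
  rw [Set.mem_Ico, le_div_iff₀ hp0, div_lt_iff₀ hp0, zero_mul,
    mul_nonneg_iff_of_pos_right Real.pi_pos, mul_right_comm,
    mul_lt_mul_iff_left₀ Real.pi_pos]
  norm_cast

/-- If `α ∈ Θ*` then `Θ_α ∩ [0, 2π)` contains exactly `p` elements, each of which
belongs to `Θ*`. -/
theorem ThetaAlpha_card_of_mem (p : ℕ) (hp : 0 < p) (α : ℝ)
    (hα : α ∈ ThetaStar p) :
    (ThetaAlpha p α ∩ Set.Ico (0 : ℝ) (2 * Real.pi)).ncard = p ∧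
      ThetaAlpha p α ∩ Set.Ico (0 : ℝ) (2 * Real.pi) ⊆ ThetaStar p := by
  obtain ⟨r, hr0, hr2, hmem⟩ := exists_mem_ThetaAlpha_iff hp hα
  refine ⟨?_, fun θ hθ => ?_⟩
  · let f : ℤ → ℝ := fun k => ((2 * k + r : ℤ) : ℝ) * Real.pi / p
    have hf : Function.Injective f := fun a b hab => by
      have hp0 : (p : ℝ) ≠ 0 := by positivity
      have h : 2 * a + r = 2 * b + r := by
        exact_mod_cast mul_right_cancel₀ Real.pi_ne_zero ((div_left_inj' hp0).mp hab)
      omega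
    have himage : ThetaAlpha p α ∩ Set.Ico (0 : ℝ) (2 * Real.pi) =
        f '' (Finset.Ico (0 : ℤ) p : Set ℤ) := by
      ext θ
      simp only [Set.mem_inter_iff, hmem, Set.mem_image, Finset.coe_Ico]
      constructor
      · rintro ⟨⟨k, rfl⟩, hk⟩
        rw [int_mul_pi_div_mem_Ico_iff hp] at hk
        exact ⟨k, ⟨by omega, by omega⟩, rfl⟩
      · rintro ⟨k, ⟨hk0, hkp⟩, rfl⟩
        exact ⟨⟨k, rfl⟩, (int_mul_pi_div_mem_Ico_iff hp _).mpr ⟨by omega, by omega⟩⟩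
    rw [himage, Set.ncard_image_of_injective _ hf, Set.ncard_coe_finset]
    simp
  · obtain ⟨k, hk⟩ := (hmem θ).mp hθ.1
    exact ⟨2 * k + r, hk⟩
end
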